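/- Let k ≥ 3 be an integer. For every state s₀ of the grid chain and every integer t with 0 ≤ t ≤ k, there exists a node v ∈ {0,…,k−1}² such that |∑_{l ∈ {E,N,W,S}} P̃ᵗ(s₀, (v,l)) − 1/k²| ≥ 5/27. Consequently the ε-averaging time of the LADA algorithm on the k×k grid exceeds k for every constant 0 < ε < 5/27, i.e., T_ave(ε) = Θ(k) for sufficiently small constant ε. -/

import Mathlib

/-- One move of the grid random walk on the `k × k` grid: from position `(x, y)`
heading in direction `d` (`0 = E`, `1 = N`, `2 = W`, `3 = S`), move one step in
direction `d`, bouncing back (reversing direction while staying at the same node)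
at the boundary. -/
def gridMove {k : ℕ} (x y : Fin k) (d : Fin 4) : Fin k × Fin k × Fin 4 :=
  if d = 0 then
    if h : (x : ℕ) + 1 < k then (⟨(x : ℕ) + 1, h⟩, y, 0) else (x, y, 2)
  else if d = 1 then
    if h : (y : ℕ) + 1 < k then (x, ⟨(y : ℕ) + 1, h⟩, 1) else (x, y, 3)
  else if d = 2 then
    if 0 < (x : ℕ) then (⟨(x : ℕ) - 1, lt_of_le_of_lt (Nat.sub_le _ _) x.isLt⟩, y, 2)
    else (x, y, 0)
  else
    if 0 < (y : ℕ) then (x, ⟨(y : ℕ) - 1, lt_of_le_of_lt (Nat.sub_le _ _) y.isLt⟩, 3)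
    else (x, y, 1)

/-- The nonreversible grid chain `P̃` on the state space
`{0,…,k−1} × {0,…,k−1} × {E,N,W,S}`: with probability `1 − 1/k` keep the current
direction (bouncing at the boundary), and with probability `1/(2k)` each make a
90-degree turn to either side, moving one step in the turned direction (a turn
toward a nonexistent neighbor being redirected to the corresponding state of the
current node). -/
noncomputable def gridChain (k : ℕ) :
    Matrix (Fin k × Fin k × Fin 4) (Fin k × Fin k × Fin 4) ℝ := fun s s' =>
  (1 - 1 / (k : ℝ)) * (if gridMove s.1 s.2.1 s.2.2 = s' then 1 else 0)
    + (1 / (2 * (k : ℝ))) * (if gridMove s.1 s.2.1 (s.2.2 + 1) = s' then 1 else 0)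
    + (1 / (2 * (k : ℝ))) * (if gridMove s.1 s.2.1 (s.2.2 + 3) = s' then 1 else 0)

theorem gridChain_nonneg {k : ℕ} (hk : 1 ≤ k) (s s' : Fin k × Fin k × Fin 4) :
    0 ≤ gridChain k s s' := by
  have h : (0 : ℝ) ≤ 1 - 1 / (k : ℝ) := by
    rw [sub_nonneg, div_le_one (by positivity)]
    exact_mod_cast hk
  unfold gridChain
  positivity

theorem one_sub_inv_le_gridChain_gridMove {k : ℕ} (s : Fin k × Fin k × Fin 4) :
    1 - 1 / (k : ℝ) ≤ gridChain k s (gridMove s.1 s.2.1 s.2.2) := by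
  unfold gridChain
  rw [if_pos rfl, mul_one, add_assoc]
  exact le_add_of_nonneg_right (by positivity)

theorem gridChain_pow_nonneg {k : ℕ} (hk : 1 ≤ k) (t : ℕ) (s s' : Fin k × Fin k × Fin 4) :
    0 ≤ (gridChain k ^ t) s s' := by
  induction t generalizing s' with
  | zero =>
    rw [pow_zero, Matrix.one_apply]
    positivity
  | succ t ih =>
    rw [pow_succ, Matrix.mul_apply]
    exact Finset.sum_nonneg fun u _ => mul_nonneg (ih u) (gridChain_nonneg hk u s')

/-- Some state carries at least the probability of never turning. -/
theorem exists_pow_le_gridChain_pow {k : ℕ} (hk : 1 ≤ k) (s : Fin k × Fin k × Fin 4) (t : ℕ) :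
    ∃ s', (1 - 1 / (k : ℝ)) ^ t ≤ (gridChain k ^ t) s s' := by
  have h : (0 : ℝ) ≤ 1 - 1 / (k : ℝ) := by
    rw [sub_nonneg, div_le_one (by positivity)]
    exact_mod_cast hk
  induction t with
  | zero => exact ⟨s, by simp⟩
  | succ t ih =>
    obtain ⟨u, hu⟩ := ih
    refine ⟨gridMove u.1 u.2.1 u.2.2, ?_⟩
    rw [pow_succ, pow_succ, Matrix.mul_apply]
    calc (1 - 1 / (k : ℝ)) ^ t * (1 - 1 / (k : ℝ))
        ≤ (gridChain k ^ t) s u * gridChain k u (gridMove u.1 u.2.1 u.2.2) :=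
          mul_le_mul hu (one_sub_inv_le_gridChain_gridMove u) h (gridChain_pow_nonneg hk t s u)
      _ ≤ _ := Finset.single_le_sum
          (f := fun v => (gridChain k ^ t) s v * gridChain k v (gridMove u.1 u.2.1 u.2.2))
          (fun v _ => mul_nonneg (gridChain_pow_nonneg hk t s v) (gridChain_nonneg hk v _))
          (Finset.mem_univ u)

theorem eight_div_le_one_sub_inv_pow {k : ℕ} (hk : 3 ≤ k) :
    (8 / 27 : ℝ) ≤ (1 - 1 / (k : ℝ)) ^ k := by
  have hk' : (3 : ℝ) ≤ k := by exact_mod_cast hk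
  have hinv : 1 / (k : ℝ) ≤ 1 := by
    rw [div_le_one (by positivity)]
    linarith
  have hbern := one_add_mul_self_le_rpow_one_add (s := -(1 / (k : ℝ))) (p := (k : ℝ) / 3)
    (by linarith) (by linarith)
  have hlin : 1 + (k : ℝ) / 3 * -(1 / (k : ℝ)) = 2 / 3 := by
    field_simp
    norm_num
  rw [hlin, ← sub_eq_add_neg] at hbern
  calc (8 / 27 : ℝ) = (2 / 3) ^ 3 := by norm_num
    _ ≤ ((1 - 1 / (k : ℝ)) ^ ((k : ℝ) / 3)) ^ 3 := by gcongr
    _ = (1 - 1 / (k : ℝ)) ^ k := by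
      rw [← Real.rpow_mul_natCast (by linarith), ← Real.rpow_natCast]
      congr 1
      push_cast
      ring

/-- For every `k ≥ 3`, every starting state `s₀` of the grid chain,
and every `0 ≤ t ≤ k`, there is a node `v` of the `k × k` grid whose total `t`-step
probability mass (summed over the four directional states) deviates from `1/k²` by at
least `5/27`; consequently the ε-averaging time of the LADA algorithm on the grid
exceeds `k` for every constant `0 < ε < 5/27`, i.e. `T_ave(ε) = Θ(k)` for sufficiently
small constant `ε`. -/
theorem stmt9 (k : ℕ) (hk : 3 ≤ k) (s₀ : Fin k × Fin k × Fin 4) (t : ℕ) (ht : t ≤ k) :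
    ∃ v : Fin k × Fin k,
      5 / 27 ≤ |(∑ l : Fin 4, (gridChain k ^ t) s₀ (v.1, v.2, l)) - 1 / (k : ℝ) ^ 2| := by
  obtain ⟨⟨x, y, d⟩, hs⟩ := exists_pow_le_gridChain_pow (by lia) s₀ t
  refine ⟨(x, y), le_trans ?_ (le_abs_self _)⟩
  have hk' : (3 : ℝ) ≤ k := by exact_mod_cast hk
  have hinv : 1 / (k : ℝ) ≤ 1 := by
    rw [div_le_one (by positivity)]
    linarith
  have hpow : (1 - 1 / (k : ℝ)) ^ k ≤ (1 - 1 / (k : ℝ)) ^ t :=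
    pow_le_pow_of_le_one (by linarith) (sub_le_self _ (by positivity)) ht
  have hsum : (gridChain k ^ t) s₀ (x, y, d) ≤ ∑ l : Fin 4, (gridChain k ^ t) s₀ (x, y, l) :=
    Finset.single_le_sum (f := fun l => (gridChain k ^ t) s₀ (x, y, l))
      (fun l _ => gridChain_pow_nonneg (by lia) t s₀ _) (Finset.mem_univ d)
  have hunif : 1 / (k : ℝ) ^ 2 ≤ 1 / 9 :=
    one_div_le_one_div_of_le (by norm_num) (by nlinarith)
  linarith [eight_div_le_one_sub_inv_pow hk]
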